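/- For every strict clique decomposition L of Fin 5 there exists a permutation σ of Fin 5 such that the family obtained by taking the image of each member of L under σ is one of the following four families: (i) the family of all 2-element subsets of Fin 5; (ii) {{0,1,2,3},{0,4},{1,4},{2,4},{3,4}}; (iii) {{0,1,2},{0,3},{1,3},{2,3},{0,4},{1,4},{2,4},{3,4}}; (iv) {{0,1,2},{2,3,4},{0,3},{0,4},{1,3},{1,4}}. (This is the combinatorial core of Proposition 5.3, the completeness of the list of relations of the form T_{b_1}^{a_1}⋯T_{b_5}^{a_5}T_{b_6} = T_{α_1}⋯T_{α_m} on the mapping class monoid of the 6-holed sphere: the possible configurations of enclosed-point sets are: all pairs; one 4-set plus a pencil; one 3-set plus pairs; or two 3-sets sharing exactly one point plus pairs.) -/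

import Mathlib

/-- A family of proper subsets of `α` with at least two elements such that every pair of distinct
points lies in exactly one member. -/
structure IsStrictCliqueDecomposition {α : Type*} [Fintype α] [DecidableEq α]
    (L : Finset (Finset α)) : Prop where
  two_le_card : ∀ l ∈ L, 2 ≤ l.card
  card_lt : ∀ l ∈ L, l.card < Fintype.card α
  existsUnique : ∀ p q : α, p ≠ q → ∃! l : Finset α, l ∈ L ∧ p ∈ l ∧ q ∈ l

namespace IsStrictCliqueDecomposition

variable {α : Type*} [Fintype α] [DecidableEq α] {L : Finset (Finset α)}

theorem card_inter_le_one (h : IsStrictCliqueDecomposition L) {l l' : Finset α}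
    (hl : l ∈ L) (hl' : l' ∈ L) (hne : l ≠ l') : (l ∩ l').card ≤ 1 := by
  by_contra! hcard
  obtain ⟨p, hp, q, hq, hpq⟩ := Finset.one_lt_card.mp hcard
  rw [Finset.mem_inter] at hp hq
  exact hne ((h.existsUnique p q hpq).unique ⟨hl, hp.1, hq.1⟩ ⟨hl', hp.2, hq.2⟩)

theorem image_perm (h : IsStrictCliqueDecomposition L) (σ : Equiv.Perm α) :
    IsStrictCliqueDecomposition (L.image fun s => s.image σ) where
  two_le_card := by
    simpa [Finset.card_image_of_injective _ σ.injective] using h.two_le_card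
  card_lt := by
    simpa [Finset.card_image_of_injective _ σ.injective] using h.card_lt
  existsUnique p q hpq := by
    obtain ⟨l, ⟨hl, hp, hq⟩, huniq⟩ :=
      h.existsUnique (σ.symm p) (σ.symm q) (σ.symm.injective.ne hpq)
    refine ⟨l.image σ, ⟨Finset.mem_image_of_mem _ hl, ?_, ?_⟩, ?_⟩
    · exact Finset.mem_image.mpr ⟨_, hp, σ.apply_symm_apply p⟩
    · exact Finset.mem_image.mpr ⟨_, hq, σ.apply_symm_apply q⟩
    · rintro _ ⟨hm, hpm, hqm⟩
      obtain ⟨m, hmL, rfl⟩ := Finset.mem_image.mp hm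
      obtain ⟨a, ha, rfl⟩ := Finset.mem_image.mp hpm
      obtain ⟨b, hb, rfl⟩ := Finset.mem_image.mp hqm
      rw [huniq m ⟨hmL, by simpa using ha, by simpa using hb⟩]

/-- A strict clique decomposition is determined by its members with at least three points. -/
theorem eq_union_filter_powersetCard (h : IsStrictCliqueDecomposition L)
    {T : Finset (Finset α)} (hT : ∀ l, l ∈ T ↔ l ∈ L ∧ 3 ≤ l.card) :
    L = T ∪ (Finset.univ.powersetCard 2).filter fun s => ∀ B ∈ T, ¬ s ⊆ B := by
  ext s
  simp only [Finset.mem_union, Finset.mem_filter, Finset.mem_powersetCard_univ]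
  constructor
  · intro hs
    by_cases h3 : 3 ≤ s.card
    · exact Or.inl ((hT s).mpr ⟨hs, h3⟩)
    · have h2 := h.two_le_card s hs
      refine Or.inr ⟨by lia, fun B hB hsB => ?_⟩
      obtain ⟨hBL, hB3⟩ := (hT B).mp hB
      have hi := h.card_inter_le_one hs hBL (by rintro rfl; exact h3 hB3)
      rw [Finset.inter_eq_left.mpr hsB] at hi
      lia
  · rintro (hs | ⟨hs, hsT⟩)
    · exact ((hT s).mp hs).1
    · obtain ⟨p, q, hpq, rfl⟩ := Finset.card_eq_two.mp hs
      obtain ⟨l, ⟨hl, hp, hq⟩, -⟩ := h.existsUnique p q hpq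
      have hsub : {p, q} ⊆ l := by simp [Finset.insert_subset_iff, hp, hq]
      have h3 : ¬ 3 ≤ l.card := fun h3 => hsT l ((hT l).mpr ⟨hl, h3⟩) hsub
      rwa [Finset.eq_of_subset_of_card_le hsub (by lia)]

end IsStrictCliqueDecomposition

theorem exists_perm_image_eq_of_card_eq {α : Type*} [Fintype α] [DecidableEq α]
    {A B : Finset α} (h : A.card = B.card) : ∃ σ : Equiv.Perm α, A.image σ = B := by
  let e : A ≃ B := Finset.equivOfCardEq h
  refine ⟨e.extendSubtype, Finset.eq_of_subset_of_card_le ?_ ?_⟩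
  · exact Finset.image_subset_iff.mpr fun x hx => e.extendSubtype_mem x hx
  · rw [Finset.card_image_of_injective _ (Equiv.injective _), h]

theorem exists_perm_image_eq_of_card_inter_le_one {A B : Finset (Fin 5)}
    (hA : A.card = 3) (hB : B.card = 3) (hAB : (A ∩ B).card ≤ 1) :
    ∃ σ : Equiv.Perm (Fin 5), A.image σ = {0, 1, 2} ∧ B.image σ = {2, 3, 4} := by
  obtain ⟨σ, hσ⟩ := exists_perm_image_eq_of_card_eq (B := ({0, 1, 2} : Finset (Fin 5))) hA
  have key : ∀ C : Finset (Fin 5), C.card = 3 → ({0, 1, 2} ∩ C).card ≤ 1 →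
      ∃ c : Fin 5, ({0, 1, 2} : Finset (Fin 5)).image (Equiv.swap c 2) = {0, 1, 2} ∧
        C.image (Equiv.swap c 2) = {2, 3, 4} := by
    decide
  obtain ⟨c, hcA, hcB⟩ := key (B.image σ)
    (by rw [Finset.card_image_of_injective _ σ.injective, hB])
    (by rwa [← hσ, ← Finset.image_inter _ _ σ.injective,
      Finset.card_image_of_injective _ σ.injective])
  refine ⟨σ.trans (Equiv.swap c 2), ?_, ?_⟩
  · rw [Equiv.coe_trans, ← Finset.image_image, hσ, hcA]
  · rw [Equiv.coe_trans, ← Finset.image_image, hcB]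

theorem card_lt_three_of_card_inter_le_one {C : Finset (Fin 5)}
    (h₁ : (C ∩ {0, 1, 2}).card ≤ 1) (h₂ : (C ∩ {2, 3, 4}).card ≤ 1) : C.card < 3 := by
  revert C
  decide

/-- Combinatorial core of Proposition 5.3: up to a permutation of `Fin 5`,
every strict clique decomposition of `Fin 5` is one of four families:
all pairs; one 4-set plus a pencil; one 3-set plus pairs; or two 3-sets
sharing exactly one point plus pairs. -/
theorem clique_decomposition_fin_five_classification
    (L : Finset (Finset (Fin 5)))
    (hcard : ∀ l ∈ L, 2 ≤ l.card ∧ l.card ≤ 4)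
    (hpair : ∀ p q : Fin 5, p ≠ q → ∃! l : Finset (Fin 5), l ∈ L ∧ p ∈ l ∧ q ∈ l) :
    ∃ σ : Equiv.Perm (Fin 5),
      L.image (fun s => s.image σ) = (Finset.univ : Finset (Fin 5)).powersetCard 2 ∨
      L.image (fun s => s.image σ) =
        ({{0, 1, 2, 3}, {0, 4}, {1, 4}, {2, 4}, {3, 4}} : Finset (Finset (Fin 5))) ∨
      L.image (fun s => s.image σ) =
        ({{0, 1, 2}, {0, 3}, {1, 3}, {2, 3}, {0, 4}, {1, 4}, {2, 4},
          {3, 4}} : Finset (Finset (Fin 5))) ∨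
      L.image (fun s => s.image σ) =
        ({{0, 1, 2}, {2, 3, 4}, {0, 3}, {0, 4}, {1, 3}, {1, 4}} : Finset (Finset (Fin 5))) := by
  have h : IsStrictCliqueDecomposition L :=
    ⟨fun l hl => (hcard l hl).1, fun l hl => by simpa using Nat.lt_succ_of_le (hcard l hl).2,
      hpair⟩
  by_cases h4 : ∃ A ∈ L, A.card = 4
  · obtain ⟨A, hA, hA4⟩ := h4
    obtain ⟨σ, hσ⟩ := exists_perm_image_eq_of_card_eq (B := ({0, 1, 2, 3} : Finset (Fin 5))) hA4
    have hσL := h.image_perm σ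
    have hmem := Finset.mem_image_of_mem (fun s => s.image σ) hA
    simp only [hσ] at hmem
    refine ⟨σ, Or.inr (Or.inl ?_)⟩
    rw [hσL.eq_union_filter_powersetCard (T := {{0, 1, 2, 3}})]
    · decide
    · intro l
      rw [Finset.mem_singleton]
      refine ⟨by rintro rfl; exact ⟨hmem, by decide⟩, fun ⟨hl, hl3⟩ => ?_⟩
      by_contra hne
      have hi := hσL.card_inter_le_one hl hmem hne
      have hu := Finset.card_union_add_card_inter l {0, 1, 2, 3}
      have hle := Finset.card_le_univ (l ∪ {0, 1, 2, 3})
      have hc : ({0, 1, 2, 3} : Finset (Fin 5)).card = 4 := by decide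
      rw [Fintype.card_fin] at hle
      lia
  have hL3 : ∀ l ∈ L, 3 ≤ l.card → l.card = 3 := fun l hl hl3 => by
    have := (hcard l hl).2
    have : l.card ≠ 4 := fun hl4 => h4 ⟨l, hl, hl4⟩
    lia
  by_cases h3 : ∃ A ∈ L, 3 ≤ A.card
  · obtain ⟨A, hA, hA3⟩ := h3
    replace hA3 := hL3 A hA hA3
    by_cases h33 : ∃ B ∈ L, 3 ≤ B.card ∧ A ≠ B
    · obtain ⟨B, hB, hB3, hAB⟩ := h33
      obtain ⟨σ, hσA, hσB⟩ := exists_perm_image_eq_of_card_inter_le_one hA3 (hL3 B hB hB3)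
        (h.card_inter_le_one hA hB hAB)
      have hσL := h.image_perm σ
      have hmemA := Finset.mem_image_of_mem (fun s => s.image σ) hA
      have hmemB := Finset.mem_image_of_mem (fun s => s.image σ) hB
      simp only [hσA] at hmemA
      simp only [hσB] at hmemB
      refine ⟨σ, Or.inr (Or.inr (Or.inr ?_))⟩
      rw [hσL.eq_union_filter_powersetCard (T := {{0, 1, 2}, {2, 3, 4}})]
      · decide
      · intro l
        rw [Finset.mem_insert, Finset.mem_singleton]
        constructor
        · rintro (rfl | rfl)
          · exact ⟨hmemA, by decide⟩
          · exact ⟨hmemB, by decide⟩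
        · rintro ⟨hl, hl3⟩
          by_contra! hne
          exact (card_lt_three_of_card_inter_le_one (hσL.card_inter_le_one hl hmemA hne.1)
            (hσL.card_inter_le_one hl hmemB hne.2)).not_ge hl3
    · push Not at h33
      obtain ⟨σ, hσ⟩ := exists_perm_image_eq_of_card_eq (B := ({0, 1, 2} : Finset (Fin 5))) hA3
      have hσL := h.image_perm σ
      refine ⟨σ, Or.inr (Or.inr (Or.inl ?_))⟩
      rw [hσL.eq_union_filter_powersetCard (T := {{0, 1, 2}})]
      · decide
      · intro l
        rw [Finset.mem_singleton]
        constructor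
        · rintro rfl
          exact ⟨Finset.mem_image.mpr ⟨A, hA, hσ⟩, by decide⟩
        · rintro ⟨hl, hl3⟩
          obtain ⟨B, hB, rfl⟩ := Finset.mem_image.mp hl
          rw [Finset.card_image_of_injective _ σ.injective] at hl3
          rw [← h33 B hB hl3, hσ]
  · push Not at h3
    refine ⟨1, Or.inl ?_⟩
    rw [(h.image_perm 1).eq_union_filter_powersetCard (T := ∅)]
    · simp
    · intro l
      simpa using h3 l
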